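/- arXiv:2012.02188 — 8 statements merged into one kernel-verified Lean document; each statement's English description precedes it below -/
import Mathlib

section
/- Suppose FRGD sequences (w_n), (r_n), (p_n) in ℝ^d satisfy the approximate-Hessian hypotheses with constants C, λmin, λmax and horizon K, and suppose the step size satisfies α ≤ λmin / ((λmax² + 2·C·d·‖r_0‖)·K²). Then for every n with 1 ≤ n ≤ K one has ⟨r_n, p_n⟩ ≥ ‖r_n‖² > 0 (so p_n is a descent direction) and ‖r_n‖ ≤ √(1 − α·λmin) · ‖r_{n−1}‖. -/
open scoped RealInnerProductSpace

/-- The spectral norm (operator norm induced by the Euclidean vector norms) of a real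
rectangular matrix. -/
noncomputable def specNorm {m n : ℕ} (M : Matrix (Fin m) (Fin n) ℝ) : ℝ :=
  ‖LinearMap.toContinuousLinearMap (Matrix.toEuclideanLin M)‖

section StepLemmas

variable {E : Type*} [NormedAddCommGroup E] [InnerProductSpace ℝ E]

/-- One residual step contracts the squared norm when the direction is `A`-aligned. -/
lemma norm_sq_residual_step_le {α l L k : ℝ} {r p r' : E} {A : E →L[ℝ] E}
    (hα : 0 < α) (hA : ‖A‖ ≤ L) (hr' : r' = r - α • A p)
    (hpk : ‖p‖ ≤ k * ‖r‖) (hrAp : l * ‖r‖ ^ 2 ≤ ⟪r, A p⟫)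
    (hsmall : α * L ^ 2 * k ^ 2 ≤ l) :
    ‖r'‖ ^ 2 ≤ (1 - α * l) * ‖r‖ ^ 2 := by
  have hL : 0 ≤ L := (norm_nonneg A).trans hA
  have hAp : ‖A p‖ ≤ L * (k * ‖r‖) :=
    (A.le_of_opNorm_le hA p).trans (mul_le_mul_of_nonneg_left hpk hL)
  have hAp2 : ‖A p‖ ^ 2 ≤ (L * (k * ‖r‖)) ^ 2 := pow_le_pow_left₀ (norm_nonneg _) hAp 2
  have hexp : ‖r'‖ ^ 2 = ‖r‖ ^ 2 - 2 * α * ⟪r, A p⟫ + α ^ 2 * ‖A p‖ ^ 2 := by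
    rw [hr', norm_sub_sq_real, norm_smul, mul_pow, Real.norm_eq_abs, sq_abs, inner_smul_right]
    ring
  have h1 := mul_le_mul_of_nonneg_left hrAp hα.le
  have h2 := mul_le_mul_of_nonneg_left hAp2 (sq_nonneg α)
  have h3 := mul_le_mul_of_nonneg_left hsmall (mul_nonneg hα.le (sq_nonneg ‖r‖))
  nlinarith

/-- The Fletcher–Reeves update preserves the descent property. -/
lemma norm_sq_le_inner_fletcher_reeves {α l L k : ℝ} {r p r' p' : E} {A : E →L[ℝ] E}
    (hα : 0 < α) (hl : 0 < l) (hlL : l ≤ L) (hA : ‖A‖ ≤ L) (hr' : r' = r - α • A p)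
    (hp' : p' = r' + (‖r'‖ ^ 2 / ‖r‖ ^ 2) • p)
    (hpk : ‖p‖ ≤ k * ‖r‖) (hrp : ‖r‖ ^ 2 ≤ ⟪r, p⟫)
    (hsmall : α * L ^ 2 * k ^ 2 ≤ l) :
    ‖r'‖ ^ 2 ≤ ⟪r', p'⟫ := by
  have hL : 0 < L := hl.trans_le hlL
  have hLk : α * L * k ^ 2 ≤ 1 := by
    refine le_of_mul_le_mul_left ?_ hL
    nlinarith
  have hAp : ⟪A p, p⟫ ≤ L * (k * ‖r‖) ^ 2 := calc
    ⟪A p, p⟫ ≤ ‖A p‖ * ‖p‖ := real_inner_le_norm _ _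
    _ ≤ L * ‖p‖ * ‖p‖ := by gcongr; exact A.le_of_opNorm_le hA p
    _ = L * ‖p‖ ^ 2 := by ring
    _ ≤ L * (k * ‖r‖) ^ 2 := by gcongr
  have hr'p : 0 ≤ ⟪r', p⟫ := by
    rw [hr', inner_sub_left, real_inner_smul_left]
    have h1 := mul_le_mul_of_nonneg_left hAp hα.le
    have h2 := mul_le_mul_of_nonneg_right hLk (sq_nonneg ‖r‖)
    nlinarith
  rw [hp', inner_add_right, real_inner_smul_right, real_inner_self_eq_norm_sq]
  have : 0 ≤ ‖r'‖ ^ 2 / ‖r‖ ^ 2 * ⟪r', p⟫ := by positivity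
  linarith

/-- Under the Fletcher–Reeves update with non-increasing residuals, the ratio of the norms of
direction and residual grows by at most one. -/
lemma norm_fletcher_reeves_le {k : ℝ} {r p r' p' : E} (hk : 0 ≤ k) (hr : r ≠ 0)
    (hle : ‖r'‖ ≤ ‖r‖) (hp' : p' = r' + (‖r'‖ ^ 2 / ‖r‖ ^ 2) • p) (hpk : ‖p‖ ≤ k * ‖r‖) :
    ‖p'‖ ≤ (k + 1) * ‖r'‖ := by
  have hr0 : 0 < ‖r‖ := norm_pos_iff.mpr hr
  calc ‖p'‖ ≤ ‖r'‖ + ‖r'‖ ^ 2 / ‖r‖ ^ 2 * ‖p‖ := by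
        rw [hp']
        refine (norm_add_le _ _).trans_eq ?_
        rw [norm_smul, Real.norm_of_nonneg (by positivity)]
    _ ≤ ‖r'‖ + ‖r'‖ ^ 2 / ‖r‖ ^ 2 * (k * ‖r‖) := by gcongr
    _ = ‖r'‖ + k * ‖r'‖ * (‖r'‖ / ‖r‖) := by field_simp
    _ ≤ ‖r'‖ + k * ‖r'‖ * 1 := by gcongr; exact (div_le_one hr0).mpr hle
    _ = (k + 1) * ‖r'‖ := by ring

/-- The alignment `l * ‖r‖ ^ 2 ≤ ⟪r, A p⟫` survives a Fletcher–Reeves step and a slow change of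
the operator from `A` to `B`. -/
lemma mul_norm_sq_le_inner_fletcher_reeves {α l L k c R : ℝ} {r p r' p' : E} {A B : E →L[ℝ] E}
    (hα : 0 < α) (hk : 0 ≤ k) (hc : 0 ≤ c) (hA : ‖A‖ ≤ L) (hr' : r' = r - α • A p)
    (hp' : p' = r' + (‖r'‖ ^ 2 / ‖r‖ ^ 2) • p)
    (hle : ‖r'‖ ≤ ‖r‖) (hrR : ‖r‖ ≤ R)
    (hpk : ‖p‖ ≤ k * ‖r‖) (hpk' : ‖p'‖ ≤ (k + 1) * ‖r'‖)
    (hrAp : l * ‖r‖ ^ 2 ≤ ⟪r, A p⟫)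
    (hB : l * ‖r'‖ ^ 2 ≤ ⟪r', B r'⟫) (hBA : ‖B - A‖ ≤ c * (‖p'‖ + ‖p‖))
    (hsmall : α * L ^ 2 * k ^ 2 + c * R * (k * (2 * k + 1)) ≤ l) :
    l * ‖r'‖ ^ 2 ≤ ⟪r', B p'⟫ := by
  have hL : 0 ≤ L := (norm_nonneg A).trans hA
  have hAp : ‖A p‖ ≤ L * (k * ‖r‖) :=
    (A.le_of_opNorm_le hA p).trans (mul_le_mul_of_nonneg_left hpk hL)
  have hAp2 : ‖A p‖ ^ 2 ≤ (L * (k * ‖r‖)) ^ 2 := pow_le_pow_left₀ (norm_nonneg _) hAp 2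
  have hdiff : -⟪r', (B - A) p⟫ ≤ c * R * (k * (2 * k + 1)) * ‖r‖ ^ 2 := calc
    -⟪r', (B - A) p⟫ ≤ ‖r'‖ * ‖(B - A) p‖ :=
        (neg_le_abs _).trans (abs_real_inner_le_norm _ _)
    _ ≤ ‖r'‖ * (c * (‖p'‖ + ‖p‖) * ‖p‖) := by
        gcongr
        exact (B - A).le_of_opNorm_le hBA p
    _ ≤ R * (c * ((k + 1) * ‖r‖ + k * ‖r‖) * (k * ‖r‖)) := by
        have hp'r : ‖p'‖ ≤ (k + 1) * ‖r‖ := hpk'.trans (by gcongr)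
        have hR : 0 ≤ R := (norm_nonneg r).trans hrR
        gcongr
        exact hle.trans hrR
    _ = c * R * (k * (2 * k + 1)) * ‖r‖ ^ 2 := by ring
  have hr'Ap : ⟪r', A p⟫ = ⟪r, A p⟫ - α * ‖A p‖ ^ 2 := by
    rw [hr', inner_sub_left, real_inner_smul_left, real_inner_self_eq_norm_sq]
  have hr'Bp : 0 ≤ ⟪r', B p⟫ := by
    have hsplit : ⟪r', B p⟫ = ⟪r', A p⟫ + ⟪r', (B - A) p⟫ := by
      rw [sub_apply, inner_sub_right]
      ring
    have h1 := mul_le_mul_of_nonneg_left hAp2 hα.le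
    have h2 := mul_le_mul_of_nonneg_right hsmall (sq_nonneg ‖r‖)
    nlinarith
  have hexp : ⟪r', B p'⟫ = ⟪r', B r'⟫ + ‖r'‖ ^ 2 / ‖r‖ ^ 2 * ⟪r', B p⟫ := by
    conv_lhs => rw [hp', map_add, map_smul, inner_add_right, real_inner_smul_right]
  have : 0 ≤ ‖r'‖ ^ 2 / ‖r‖ ^ 2 * ⟪r', B p⟫ := by positivity
  linarith

end StepLemmas

/-- FRGD with step size `α ≤ λmin / ((λmax² + 2·C·d·‖r_0‖)·K²)` under the
approximate-Hessian hypotheses satisfies, for `1 ≤ n ≤ K`,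
`⟨r_n, p_n⟩ ≥ ‖r_n‖² > 0` and `‖r_n‖ ≤ √(1 − α·λmin)·‖r_{n−1}‖`. -/
theorem frgd_descent_and_contraction {d : ℕ} (α C lmin lmax : ℝ) (K : ℕ)
    (w r p : ℕ → EuclideanSpace ℝ (Fin d)) (H : ℕ → Matrix (Fin d) (Fin d) ℝ)
    (hα : 0 < α) (hC : 0 < C) (hlmin : 0 < lmin) (hlm : lmin ≤ lmax) (hK : 1 ≤ K)
    (hp0 : p 0 = r 0)
    (hp : ∀ n, 1 ≤ n → p n = r n + (‖r n‖ ^ 2 / ‖r (n - 1)‖ ^ 2) • p (n - 1))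
    (hw : ∀ n, w (n + 1) = w n - α • p n)
    (hrne : ∀ n ≤ K, r n ≠ 0)
    (hH : ∀ n < K, r (n + 1) - r n = -α • Matrix.toEuclideanLin (H n) (p n))
    (hHpos : ∀ n < K, ∀ x : EuclideanSpace ℝ (Fin d),
      lmin * ‖x‖ ^ 2 ≤ ⟪x, Matrix.toEuclideanLin (H n) x⟫)
    (hHnorm : ∀ n < K, specNorm (H n) ≤ lmax)
    (hHdiff : ∀ n, 1 ≤ n → n < K →
      specNorm (H n - H (n - 1)) ≤ C * d * α * (‖p n‖ + ‖p (n - 1)‖))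
    (hstep : α ≤ lmin / ((lmax ^ 2 + 2 * C * d * ‖r 0‖) * K ^ 2)) :
    ∀ n, 1 ≤ n → n ≤ K →
      (‖r n‖ ^ 2 ≤ ⟪r n, p n⟫ ∧ 0 < ‖r n‖ ^ 2) ∧
      ‖r n‖ ≤ Real.sqrt (1 - α * lmin) * ‖r (n - 1)‖ := by
  set A : ℕ → EuclideanSpace ℝ (Fin d) →L[ℝ] EuclideanSpace ℝ (Fin d) :=
    fun n => LinearMap.toContinuousLinearMap (Matrix.toEuclideanLin (H n)) with hAdef
  have hA : ∀ n < K, ‖A n‖ ≤ lmax := hHnorm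
  have hApos : ∀ n < K, ∀ x, lmin * ‖x‖ ^ 2 ≤ ⟪x, A n x⟫ := hHpos
  have hAdiff : ∀ n, n + 1 < K → ‖A (n + 1) - A n‖ ≤ C * d * α * (‖p (n + 1)‖ + ‖p n‖) := by
    intro n hn
    have h := hHdiff (n + 1) (by omega) hn
    simpa only [specNorm, map_sub, Nat.add_sub_cancel] using h
  have hr : ∀ n < K, r (n + 1) = r n - α • A n (p n) := by
    intro n hn
    have h : r (n + 1) - r n = -α • A n (p n) := hH n hn
    rw [sub_eq_iff_eq_add.mp h, neg_smul]
    abel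
  have hp' : ∀ n, p (n + 1) = r (n + 1) + (‖r (n + 1)‖ ^ 2 / ‖r n‖ ^ 2) • p n :=
    fun n => hp (n + 1) (by omega)
  have hlmax : 0 < lmax := hlmin.trans_le hlm
  have hK' : (0 : ℝ) < K := by exact_mod_cast hK
  have hsmall : α * lmax ^ 2 * (K : ℝ) ^ 2 + 2 * (C * d * α * ‖r 0‖) * (K : ℝ) ^ 2 ≤ lmin := by
    rw [le_div_iff₀ (by positivity)] at hstep
    linarith
  have hsmall_sq : ∀ n < K, α * lmax ^ 2 * ((n : ℝ) + 1) ^ 2 ≤ lmin := by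
    intro n hn
    have hnK : (n : ℝ) + 1 ≤ K := by exact_mod_cast hn
    have h1 : α * lmax ^ 2 * ((n : ℝ) + 1) ^ 2 ≤ α * lmax ^ 2 * (K : ℝ) ^ 2 := by gcongr
    have h2 : 0 ≤ 2 * (C * d * α * ‖r 0‖) * (K : ℝ) ^ 2 := by positivity
    linarith
  have hsmall_add : ∀ n, n + 1 < K → α * lmax ^ 2 * ((n : ℝ) + 1) ^ 2 +
      C * d * α * ‖r 0‖ * (((n : ℝ) + 1) * (2 * ((n : ℝ) + 1) + 1)) ≤ lmin := by
    intro n hn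
    have hnK : (n : ℝ) + 1 + 1 ≤ K := by exact_mod_cast hn
    have h1 : α * lmax ^ 2 * ((n : ℝ) + 1) ^ 2 ≤ α * lmax ^ 2 * (K : ℝ) ^ 2 := by
      gcongr
      linarith
    have h2 : ((n : ℝ) + 1) * (2 * ((n : ℝ) + 1) + 1) ≤ 2 * (K : ℝ) ^ 2 := by
      have : (0 : ℝ) ≤ n := n.cast_nonneg
      nlinarith
    have h3 := mul_le_mul_of_nonneg_left h2 (show 0 ≤ C * d * α * ‖r 0‖ by positivity)
    linarith
  have hmono : ∀ n, ‖r (n + 1)‖ ^ 2 ≤ (1 - α * lmin) * ‖r n‖ ^ 2 → ‖r (n + 1)‖ ≤ ‖r n‖ := by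
    intro n h
    refine le_of_sq_le_sq ?_ (norm_nonneg _)
    have : 0 ≤ α * lmin * ‖r n‖ ^ 2 := by positivity
    linarith
  have inv : ∀ n < K, ‖p n‖ ≤ ((n : ℝ) + 1) * ‖r n‖ ∧ ‖r n‖ ≤ ‖r 0‖ ∧
      ‖r n‖ ^ 2 ≤ ⟪r n, p n⟫ ∧ lmin * ‖r n‖ ^ 2 ≤ ⟪r n, A n (p n)⟫ := by
    intro n
    induction n with
    | zero =>
      intro h0
      simpa [hp0] using hApos 0 h0 (r 0)
    | succ n ih =>
      intro hn
      have hn' : n < K := by omega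
      obtain ⟨hpk, hrR, hrp, hrAp⟩ := ih hn'
      have hle := hmono n
        (norm_sq_residual_step_le hα (hA n hn') (hr n hn') hpk hrAp (hsmall_sq n hn'))
      have hpk' := norm_fletcher_reeves_le (by positivity) (hrne n hn'.le) hle (hp' n) hpk
      refine ⟨by exact_mod_cast hpk', hle.trans hrR, ?_, ?_⟩
      · exact norm_sq_le_inner_fletcher_reeves hα hlmin hlm (hA n hn') (hr n hn') (hp' n) hpk hrp
          (hsmall_sq n hn')
      · exact mul_norm_sq_le_inner_fletcher_reeves hα (by positivity) (by positivity) (hA n hn')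
          (hr n hn') (hp' n) hle hrR hpk hpk' hrAp (hApos _ hn _) (hAdiff n hn) (hsmall_add n hn)
  intro n hn1 hnK
  obtain ⟨m, rfl⟩ : ∃ m, n = m + 1 := ⟨n - 1, by omega⟩
  have hm : m < K := hnK
  obtain ⟨hpk, -, hrp, hrAp⟩ := inv m hm
  refine ⟨⟨norm_sq_le_inner_fletcher_reeves hα hlmin hlm (hA m hm) (hr m hm) (hp' m) hpk hrp
    (hsmall_sq m hm), pow_pos (norm_pos_iff.mpr (hrne _ hnK)) 2⟩, ?_⟩
  have hcontr := norm_sq_residual_step_le hα (hA m hm) (hr m hm) hpk hrAp (hsmall_sq m hm)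
  rw [Nat.add_sub_cancel]
  calc ‖r (m + 1)‖ ≤ √((1 - α * lmin) * ‖r m‖ ^ 2) := Real.le_sqrt_of_sq_le hcontr
    _ = √(1 - α * lmin) * ‖r m‖ := by
      rw [Real.sqrt_mul' _ (sq_nonneg _), Real.sqrt_sq (norm_nonneg _)]
end

section
/- Suppose FRGD sequences (w_n), (r_n), (p_n) in ℝ^d satisfy the approximate-Hessian hypotheses with constants C, λmin, λmax and horizon K, and suppose α ≤ λmin / ((λmax² + 2·C·d·‖r_0‖)·K²). Then for every n with 1 ≤ n ≤ K the following three inequalities hold: ⟨r_{n−1}, H_{n−1} p_{n−1}⟩ ≥ λmin·‖r_{n−1}‖², ‖p_{n−1}‖ ≤ n·‖r_{n−1}‖, and ‖r_n‖ ≤ √(1 − α·λmin) · ‖r_{n−1}‖. -/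
open scoped RealInnerProductSpace

theorem norm_toEuclideanLin_le_specNorm {m n : ℕ} (M : Matrix (Fin m) (Fin n) ℝ)
    (x : EuclideanSpace ℝ (Fin n)) : ‖Matrix.toEuclideanLin M x‖ ≤ specNorm M * ‖x‖ :=
  (LinearMap.toContinuousLinearMap (Matrix.toEuclideanLin M)).le_opNorm x

section InnerProductSpace

variable {E : Type*} [NormedAddCommGroup E] [InnerProductSpace ℝ E]

/-- One step `x - α • y` contracts the squared norm by `1 - α * l` when `y` is sufficiently
aligned with `x` and not too long. -/
theorem norm_sub_smul_sq_le {x y : E} {α l : ℝ} (hα : 0 ≤ α)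
    (hinner : l * ‖x‖ ^ 2 ≤ ⟪x, y⟫) (hnorm : α * ‖y‖ ^ 2 ≤ l * ‖x‖ ^ 2) :
    ‖x - α • y‖ ^ 2 ≤ (1 - α * l) * ‖x‖ ^ 2 := by
  rw [norm_sub_sq_real, inner_smul_right, norm_smul, Real.norm_of_nonneg hα, mul_pow]
  nlinarith [mul_le_mul_of_nonneg_left hinner hα, mul_le_mul_of_nonneg_left hnorm hα]

/-- The Fletcher–Reeves direction `s + (‖s‖² / ‖x‖²) • q` grows by at most one multiple of `‖s‖`. -/
theorem norm_add_div_smul_le {x s q : E} {t : ℝ} (ht : 0 ≤ t) (hx : x ≠ 0)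
    (hq : ‖q‖ ≤ t * ‖x‖) (hs : ‖s‖ ≤ ‖x‖) :
    ‖s + (‖s‖ ^ 2 / ‖x‖ ^ 2) • q‖ ≤ (t + 1) * ‖s‖ := by
  have hx' : 0 < ‖x‖ := norm_pos_iff.mpr hx
  calc ‖s + (‖s‖ ^ 2 / ‖x‖ ^ 2) • q‖
      ≤ ‖s‖ + ‖(‖s‖ ^ 2 / ‖x‖ ^ 2) • q‖ := norm_add_le _ _
    _ = ‖s‖ + ‖s‖ ^ 2 / ‖x‖ ^ 2 * ‖q‖ := by
        rw [norm_smul, Real.norm_of_nonneg (by positivity)]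
    _ ≤ ‖s‖ + ‖s‖ ^ 2 / ‖x‖ ^ 2 * (t * ‖x‖) := by gcongr
    _ = ‖s‖ + t * ‖s‖ * (‖s‖ / ‖x‖) := by field_simp
    _ ≤ ‖s‖ + t * ‖s‖ * 1 := by
        gcongr
        exact (div_le_one hx').mpr hs
    _ = (t + 1) * ‖s‖ := by ring

end InnerProductSpace

/-- FRGD with step size `α ≤ λmin / ((λmax² + 2·C·d·‖r_0‖)·K²)` under the
approximate-Hessian hypotheses satisfies, for `1 ≤ n ≤ K`,
`⟨r_{n−1}, H_{n−1} p_{n−1}⟩ ≥ λmin·‖r_{n−1}‖²`, `‖p_{n−1}‖ ≤ n·‖r_{n−1}‖`, and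
`‖r_n‖ ≤ √(1 − α·λmin)·‖r_{n−1}‖`. -/
theorem frgd_induction_invariants {d : ℕ} (α C lmin lmax : ℝ) (K : ℕ)
    (w r p : ℕ → EuclideanSpace ℝ (Fin d)) (H : ℕ → Matrix (Fin d) (Fin d) ℝ)
    (hα : 0 < α) (hC : 0 < C) (hlmin : 0 < lmin) (hlm : lmin ≤ lmax) (hK : 1 ≤ K)
    (hp0 : p 0 = r 0)
    (hp : ∀ n, 1 ≤ n → p n = r n + (‖r n‖ ^ 2 / ‖r (n - 1)‖ ^ 2) • p (n - 1))
    (hw : ∀ n, w (n + 1) = w n - α • p n)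
    (hrne : ∀ n ≤ K, r n ≠ 0)
    (hH : ∀ n < K, r (n + 1) - r n = -α • Matrix.toEuclideanLin (H n) (p n))
    (hHpos : ∀ n < K, ∀ x : EuclideanSpace ℝ (Fin d),
      lmin * ‖x‖ ^ 2 ≤ ⟪x, Matrix.toEuclideanLin (H n) x⟫)
    (hHnorm : ∀ n < K, specNorm (H n) ≤ lmax)
    (hHdiff : ∀ n, 1 ≤ n → n < K →
      specNorm (H n - H (n - 1)) ≤ C * d * α * (‖p n‖ + ‖p (n - 1)‖))
    (hstep : α ≤ lmin / ((lmax ^ 2 + 2 * C * d * ‖r 0‖) * K ^ 2)) :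
    ∀ n, 1 ≤ n → n ≤ K →
      lmin * ‖r (n - 1)‖ ^ 2 ≤ ⟪r (n - 1), Matrix.toEuclideanLin (H (n - 1)) (p (n - 1))⟫ ∧
      ‖p (n - 1)‖ ≤ n * ‖r (n - 1)‖ ∧
      ‖r n‖ ≤ Real.sqrt (1 - α * lmin) * ‖r (n - 1)‖ := by
  have hlmax : 0 < lmax := hlmin.trans_le hlm
  have hr0 : 0 < ‖r 0‖ := norm_pos_iff.mpr (hrne 0 (Nat.zero_le K))
  have hK' : (1 : ℝ) ≤ K := by exact_mod_cast hK
  have hstep' : α * ((lmax ^ 2 + 2 * C * d * ‖r 0‖) * K ^ 2) ≤ lmin :=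
    (le_div_iff₀ (by positivity)).mp hstep
  have hstep_sq : α * (lmax ^ 2 * K ^ 2) ≤ lmin := by
    have : 0 ≤ α * (2 * C * d * ‖r 0‖ * K ^ 2) := by positivity
    nlinarith
  have hstep_r : ∀ n < K, r (n + 1) = r n - α • Matrix.toEuclideanLin (H n) (p n) := by
    intro n hn
    rw [← sub_add_cancel (r (n + 1)) (r n), hH n hn, neg_smul]
    abel
  have hHp : ∀ n < K, ‖p n‖ ≤ (n + 1) * ‖r n‖ →
      ‖Matrix.toEuclideanLin (H n) (p n)‖ ≤ lmax * ((n + 1) * ‖r n‖) := fun n hn hpn =>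
    (norm_toEuclideanLin_le_specNorm _ _).trans
      (mul_le_mul (hHnorm n hn) hpn (norm_nonneg _) hlmax.le)
  have hdecay : ∀ n < K,
      lmin * ‖r n‖ ^ 2 ≤ ⟪r n, Matrix.toEuclideanLin (H n) (p n)⟫ →
      ‖p n‖ ≤ (n + 1) * ‖r n‖ → ‖r (n + 1)‖ ^ 2 ≤ (1 - α * lmin) * ‖r n‖ ^ 2 := by
    intro n hn hinner hpn
    have hnK : (n : ℝ) + 1 ≤ K := by exact_mod_cast hn
    rw [hstep_r n hn]
    refine norm_sub_smul_sq_le hα.le hinner ?_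
    calc α * ‖Matrix.toEuclideanLin (H n) (p n)‖ ^ 2
        ≤ α * (lmax * (K * ‖r n‖)) ^ 2 := by
          gcongr
          exact (hHp n hn hpn).trans (by gcongr)
      _ = α * (lmax ^ 2 * K ^ 2) * ‖r n‖ ^ 2 := by ring
      _ ≤ lmin * ‖r n‖ ^ 2 := by gcongr
  have hmain : ∀ n < K, ‖r n‖ ≤ ‖r 0‖ ∧
      lmin * ‖r n‖ ^ 2 ≤ ⟪r n, Matrix.toEuclideanLin (H n) (p n)⟫ ∧
      ‖p n‖ ≤ (n + 1) * ‖r n‖ := by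
    intro n
    induction n with
    | zero =>
      intro h0
      refine ⟨le_rfl, ?_, ?_⟩
      · rw [hp0]
        exact hHpos 0 h0 _
      · simp [hp0]
    | succ n ih =>
      intro hn
      have hn' : n < K := by omega
      obtain ⟨hrn, hinner, hpn⟩ := ih hn'
      have hnK : (n : ℝ) + 1 + 1 ≤ K := by exact_mod_cast hn
      have hmono : ‖r (n + 1)‖ ≤ ‖r n‖ := by
        refine (sq_le_sq₀ (norm_nonneg _) (norm_nonneg _)).mp ?_
        have : 0 ≤ α * lmin * ‖r n‖ ^ 2 := by positivity
        linarith [hdecay n hn' hinner hpn]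
      have hpeq := hp (n + 1) (by omega)
      rw [Nat.add_sub_cancel] at hpeq
      have hp_succ : ‖p (n + 1)‖ ≤ (n + 1 + 1) * ‖r (n + 1)‖ := by
        rw [hpeq]
        exact norm_add_div_smul_le (by positivity) (hrne n hn'.le) hpn hmono
      refine ⟨hmono.trans hrn, ?_, by exact_mod_cast hp_succ⟩
      set y := Matrix.toEuclideanLin (H n) (p n) with hy
      set z := Matrix.toEuclideanLin (H (n + 1) - H n) (p n) with hz
      have hsplit : Matrix.toEuclideanLin (H (n + 1)) (p n) = y + z := by
        rw [hy, hz, map_sub, LinearMap.sub_apply]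
        abel
      have hy_inner : ⟪r (n + 1), y⟫ = ⟪r n, y⟫ - α * ‖y‖ ^ 2 := by
        rw [hstep_r n hn', inner_sub_left, real_inner_smul_left, real_inner_self_eq_norm_sq]
      have hy_norm : α * ‖y‖ ^ 2 ≤ α * (lmax ^ 2 * K ^ 2) * ‖r n‖ ^ 2 := by
        calc α * ‖y‖ ^ 2 ≤ α * (lmax * (K * ‖r n‖)) ^ 2 := by
              gcongr
              refine (hHp n hn' hpn).trans ?_
              gcongr
              linarith
          _ = α * (lmax ^ 2 * K ^ 2) * ‖r n‖ ^ 2 := by ring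
      have hz_norm : ‖z‖ ≤ C * d * α * (2 * K * ‖r n‖) * (K * ‖r n‖) := by
        have hdiff := hHdiff (n + 1) (by omega) hn
        rw [Nat.add_sub_cancel] at hdiff
        have hpn' : ‖p n‖ ≤ K * ‖r n‖ := hpn.trans (by gcongr; linarith)
        have hp_succ' : ‖p (n + 1)‖ ≤ K * ‖r n‖ := hp_succ.trans (by gcongr)
        have hsum : ‖p (n + 1)‖ + ‖p n‖ ≤ 2 * K * ‖r n‖ := by linarith
        calc ‖z‖ ≤ specNorm (H (n + 1) - H n) * ‖p n‖ := norm_toEuclideanLin_le_specNorm _ _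
          _ ≤ C * d * α * (‖p (n + 1)‖ + ‖p n‖) * ‖p n‖ := by gcongr
          _ ≤ C * d * α * (2 * K * ‖r n‖) * (K * ‖r n‖) := by gcongr
      have hz_inner : -(α * (2 * C * d * ‖r 0‖ * K ^ 2) * ‖r n‖ ^ 2) ≤ ⟪r (n + 1), z⟫ := by
        refine neg_le_of_neg_le ((neg_le_abs _).trans ((abs_real_inner_le_norm _ _).trans ?_))
        calc ‖r (n + 1)‖ * ‖z‖
            ≤ ‖r 0‖ * (C * d * α * (2 * K * ‖r n‖) * (K * ‖r n‖)) := by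
              gcongr
              exact hmono.trans hrn
          _ = α * (2 * C * d * ‖r 0‖ * K ^ 2) * ‖r n‖ ^ 2 := by ring
      have hcross : 0 ≤ ⟪r (n + 1), Matrix.toEuclideanLin (H (n + 1)) (p n)⟫ := by
        rw [hsplit, inner_add_right, hy_inner]
        linarith [mul_le_mul_of_nonneg_right hstep' (sq_nonneg ‖r n‖)]
      rw [hpeq, map_add, map_smul, inner_add_right, inner_smul_right]
      have : 0 ≤ ‖r (n + 1)‖ ^ 2 / ‖r n‖ ^ 2 *
          ⟪r (n + 1), Matrix.toEuclideanLin (H (n + 1)) (p n)⟫ := by positivity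
      linarith [hHpos (n + 1) hn (r (n + 1))]
  intro n hn1 hnK
  obtain ⟨n, rfl⟩ := Nat.exists_eq_add_of_le' hn1
  rw [Nat.add_sub_cancel]
  obtain ⟨-, hinner, hpn⟩ := hmain n hnK
  refine ⟨hinner, by exact_mod_cast hpn, ?_⟩
  rw [← Real.sqrt_sq (norm_nonneg (r n)), ← Real.sqrt_mul' _ (sq_nonneg _)]
  exact Real.le_sqrt_of_sq_le (hdecay n hnK hinner hpn)
end

section
/- Let α, λmin, λmax > 0, let m be a natural number, and let r, p ∈ ℝ^d and H a d×d real matrix satisfy ⟨r, H p⟩ ≥ λmin·‖r‖², ‖H‖ ≤ λmax (spectral norm), ‖p‖ ≤ m·‖r‖, and α·λmax²·m² ≤ λmin. Then the vector r⁺ = r − α·H·p satisfies ‖r⁺‖² ≤ (1 − α·λmin)·‖r‖². -/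
open scoped RealInnerProductSpace

/-- if `⟨r, H p⟩ ≥ λmin·‖r‖²`, `‖H‖ ≤ λmax`, `‖p‖ ≤ m·‖r‖` and
`α·λmax²·m² ≤ λmin`, then `r⁺ = r − α·H·p` satisfies `‖r⁺‖² ≤ (1 − α·λmin)·‖r‖²`. -/
theorem norm_sq_update_le {d : ℕ} (α lmin lmax : ℝ) (hα : 0 < α) (hlmin : 0 < lmin)
    (hlmax : 0 < lmax) (m : ℕ) (r p : EuclideanSpace ℝ (Fin d))
    (H : Matrix (Fin d) (Fin d) ℝ)
    (hip : lmin * ‖r‖ ^ 2 ≤ ⟪r, Matrix.toEuclideanLin H p⟫)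
    (hHnorm : specNorm H ≤ lmax)
    (hp : ‖p‖ ≤ m * ‖r‖)
    (hstep : α * lmax ^ 2 * m ^ 2 ≤ lmin) :
    ‖r - α • Matrix.toEuclideanLin H p‖ ^ 2 ≤ (1 - α * lmin) * ‖r‖ ^ 2 := by
  have hHp : ‖Matrix.toEuclideanLin H p‖ ≤ lmax * (m * ‖r‖) :=
    calc ‖Matrix.toEuclideanLin H p‖ ≤ specNorm H * ‖p‖ :=
          (LinearMap.toContinuousLinearMap (Matrix.toEuclideanLin H)).le_opNorm p
      _ ≤ lmax * (m * ‖r‖) := by gcongr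
  have hquad : α ^ 2 * ‖Matrix.toEuclideanLin H p‖ ^ 2 ≤ α * lmin * ‖r‖ ^ 2 :=
    calc α ^ 2 * ‖Matrix.toEuclideanLin H p‖ ^ 2 ≤ α ^ 2 * (lmax * (m * ‖r‖)) ^ 2 := by gcongr
      _ = α * (α * lmax ^ 2 * m ^ 2) * ‖r‖ ^ 2 := by ring
      _ ≤ α * lmin * ‖r‖ ^ 2 := by gcongr
  have hinner := mul_le_mul_of_nonneg_left hip hα.le
  rw [norm_sub_sq_real, inner_smul_right, norm_smul, Real.norm_of_nonneg hα.le, mul_pow]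
  linarith
end

section
/- Let α, λmax > 0 and let n be a natural number with α·λmax·n² ≤ 1. Let r', r, p', p ∈ ℝ^d with r' ≠ 0 and let H be a d×d real matrix with ‖H‖ ≤ λmax (spectral norm). Assume r = r' − α·H·p', p = r + (‖r‖²/‖r'‖²)·p', ⟨r', p'⟩ ≥ ‖r'‖², and ‖p'‖ ≤ n·‖r'‖. Then ⟨r, p⟩ ≥ ‖r‖². -/
open scoped RealInnerProductSpace

/-- if `α·λmax·n² ≤ 1`, `‖H‖ ≤ λmax`, `r = r' − α·H·p'`,
`p = r + (‖r‖²/‖r'‖²)·p'`, `⟨r', p'⟩ ≥ ‖r'‖²` and `‖p'‖ ≤ n·‖r'‖`, then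
`⟨r, p⟩ ≥ ‖r‖²`. -/
theorem inner_r_p_ge {d : ℕ} (α lmax : ℝ) (hα : 0 < α) (hlmax : 0 < lmax) (n : ℕ)
    (hstep : α * lmax * n ^ 2 ≤ 1)
    (r' r p' p : EuclideanSpace ℝ (Fin d)) (hr' : r' ≠ 0)
    (H : Matrix (Fin d) (Fin d) ℝ) (hHnorm : specNorm H ≤ lmax)
    (hr : r = r' - α • Matrix.toEuclideanLin H p')
    (hp : p = r + (‖r‖ ^ 2 / ‖r'‖ ^ 2) • p')
    (hip : ‖r'‖ ^ 2 ≤ ⟪r', p'⟫)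
    (hp' : ‖p'‖ ≤ n * ‖r'‖) :
    ‖r‖ ^ 2 ≤ ⟪r, p⟫ := by
  have hH : ‖Matrix.toEuclideanLin H p'‖ ≤ lmax * ‖p'‖ :=
    ((LinearMap.toContinuousLinearMap (Matrix.toEuclideanLin H)).le_opNorm p').trans
      (mul_le_mul_of_nonneg_right hHnorm (norm_nonneg p'))
  have hquad : α * ⟪Matrix.toEuclideanLin H p', p'⟫ ≤ ‖r'‖ ^ 2 :=
    calc α * ⟪Matrix.toEuclideanLin H p', p'⟫
        ≤ α * (lmax * ‖p'‖ * ‖p'‖) := by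
          gcongr
          exact (real_inner_le_norm _ _).trans (by gcongr)
      _ ≤ α * (lmax * (n * ‖r'‖) * (n * ‖r'‖)) := by gcongr
      _ = α * lmax * n ^ 2 * ‖r'‖ ^ 2 := by ring
      _ ≤ ‖r'‖ ^ 2 := mul_le_of_le_one_left (by positivity) hstep
  have hrp' : 0 ≤ ⟪r, p'⟫ := by
    rw [hr, inner_sub_left, real_inner_smul_left]
    linarith
  rw [hp, inner_add_right, real_inner_smul_right, real_inner_self_eq_norm_sq]
  exact le_add_of_nonneg_right (by positivity)
end

section
/- Suppose FRGD sequences (w_n), (r_n), (p_n) in ℝ^d satisfy the approximate-Hessian hypotheses with constants C, λmin, λmax and horizon K, and suppose α ≤ λmin / ((λmax² + 2·C·d·‖r_0‖)·K²). Then for every n with 0 ≤ n ≤ K one has ‖r_n‖ ≤ (1 − α·λmin)^{n/2} · ‖r_0‖; in particular the sequence (‖r_n‖)_{n ≤ K} is nonincreasing. -/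
open scoped RealInnerProductSpace

/-- The squared residual norm after one gradient step taken along the residual itself. -/
theorem norm_sq_residual_first_step {E : Type*} [NormedAddCommGroup E] [InnerProductSpace ℝ E]
    (T : E →L[ℝ] E) {r r' : E} {α l L : ℝ} (hα : 0 < α)
    (hstep : r' = r - α • T r) (hpos : l * ‖r‖ ^ 2 ≤ ⟪r, T r⟫) (hT : ‖T‖ ≤ L)
    (hαL : α * L ^ 2 ≤ l) :
    ‖r'‖ ^ 2 ≤ (1 - α * l) * ‖r‖ ^ 2 := by
  have hTr : ‖T r‖ ^ 2 ≤ L ^ 2 * ‖r‖ ^ 2 := by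
    rw [← mul_pow]
    exact pow_le_pow_left₀ (norm_nonneg _) (T.le_of_opNorm_le hT r) 2
  have hexp : ‖r'‖ ^ 2 = ‖r‖ ^ 2 - 2 * α * ⟪r, T r⟫ + α ^ 2 * ‖T r‖ ^ 2 := by
    rw [hstep, norm_sub_sq_real, inner_smul_right, norm_smul, Real.norm_of_nonneg hα.le]
    ring
  have h1 := mul_le_mul_of_nonneg_left hpos hα.le
  have h2 := mul_le_mul_of_nonneg_left hTr (sq_nonneg α)
  have h3 := mul_le_mul_of_nonneg_right hαL (mul_nonneg hα.le (sq_nonneg ‖r‖))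
  rw [hexp]
  linarith

/-- One Fletcher–Reeves step contracts the squared residual norm by `1 - α * l`, provided the
previous step did and the search directions are bounded by `κ` times the residuals. -/
theorem norm_sq_residual_fletcherReeves_step {E : Type*} [NormedAddCommGroup E]
    [InnerProductSpace ℝ E] (S T : E →L[ℝ] E) {r₀ r₁ r₂ p₀ p₁ : E} {α l L M R κ : ℝ}
    (hα : 0 < α) (hM : 0 ≤ M) (hκ : 0 ≤ κ) (hr₀ : r₀ ≠ 0)
    (hp : p₁ = r₁ + (‖r₁‖ ^ 2 / ‖r₀‖ ^ 2) • p₀)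
    (hS : r₁ = r₀ - α • S p₀) (hT : r₂ = r₁ - α • T p₁)
    (hpos : l * ‖r₁‖ ^ 2 ≤ ⟪r₁, T r₁⟫) (hSL : ‖S‖ ≤ L) (hTL : ‖T‖ ≤ L)
    (hTS : ‖T - S‖ ≤ M * α * (‖p₁‖ + ‖p₀‖))
    (hp₀ : ‖p₀‖ ≤ κ * ‖r₀‖) (hp₁ : ‖p₁‖ ≤ κ * ‖r₁‖)
    (hdec : ‖r₁‖ ^ 2 ≤ (1 - α * l) * ‖r₀‖ ^ 2) (hmono : ‖r₁‖ ≤ ‖r₀‖) (hR : ‖r₁‖ ≤ R)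
    (hαL : α * ((L ^ 2 + 2 * M * R) * κ ^ 2) ≤ l) :
    ‖r₂‖ ^ 2 ≤ (1 - α * l) * ‖r₁‖ ^ 2 := by
  have hr₀' : 0 < ‖r₀‖ := norm_pos_iff.mpr hr₀
  set β : ℝ := ‖r₁‖ ^ 2 / ‖r₀‖ ^ 2 with hβ
  have hβ0 : 0 ≤ β := by positivity
  have hβr : β * ‖r₀‖ ^ 2 = ‖r₁‖ ^ 2 := by rw [hβ]; field_simp
  have hSp : ‖S p₀‖ ^ 2 ≤ L ^ 2 * (κ ^ 2 * ‖r₀‖ ^ 2) := by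
    have hL : 0 ≤ L := (norm_nonneg _).trans hSL
    calc ‖S p₀‖ ^ 2 ≤ (L * (κ * ‖r₀‖)) ^ 2 := by
          refine pow_le_pow_left₀ (norm_nonneg _) ((S.le_of_opNorm_le hSL p₀).trans ?_) 2
          gcongr
      _ = _ := by ring
  have hTp : ‖T p₁‖ ^ 2 ≤ L ^ 2 * (κ ^ 2 * ‖r₁‖ ^ 2) := by
    have hL : 0 ≤ L := (norm_nonneg _).trans hSL
    calc ‖T p₁‖ ^ 2 ≤ (L * (κ * ‖r₁‖)) ^ 2 := by
          refine pow_le_pow_left₀ (norm_nonneg _) ((T.le_of_opNorm_le hTL p₁).trans ?_) 2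
          gcongr
      _ = _ := by ring
  have hexp : ‖r₂‖ ^ 2 = ‖r₁‖ ^ 2 - 2 * α * ⟪r₁, T p₁⟫ + α ^ 2 * ‖T p₁‖ ^ 2 := by
    rw [hT, norm_sub_sq_real, inner_smul_right, norm_smul, Real.norm_of_nonneg hα.le]
    ring
  have hinner : ⟪r₁, T p₁⟫ = ⟪r₁, T r₁⟫ + β * (⟪r₁, S p₀⟫ + ⟪r₁, (T - S) p₀⟫) := by
    conv_lhs => rw [hp]
    simp [inner_add_right, inner_sub_right, inner_smul_right]
  have hcross : 2 * α * ⟪r₁, S p₀⟫ = ‖r₀‖ ^ 2 - ‖r₁‖ ^ 2 - α ^ 2 * ‖S p₀‖ ^ 2 := by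
    have h : r₀ = r₁ + α • S p₀ := by rw [hS]; abel
    have h' := norm_add_sq_real r₁ (α • S p₀)
    rw [← h, inner_smul_right, norm_smul, Real.norm_of_nonneg hα.le] at h'
    linarith
  have hdrift : -(2 * M * α * κ ^ 2 * R * ‖r₀‖ ^ 2) ≤ ⟪r₁, (T - S) p₀⟫ := by
    have hR0 : 0 ≤ R := (norm_nonneg _).trans hR
    have h1 : ‖T - S‖ ≤ M * α * (2 * κ * ‖r₀‖) := by
      refine hTS.trans (mul_le_mul_of_nonneg_left ?_ (by positivity))
      have := mul_le_mul_of_nonneg_left hmono hκ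
      linarith
    have h2 : ‖(T - S) p₀‖ ≤ M * α * (2 * κ * ‖r₀‖) * (κ * ‖r₀‖) :=
      ((T - S).le_of_opNorm_le h1 p₀).trans (by gcongr)
    have h3 : ‖r₁‖ * ‖(T - S) p₀‖ ≤ R * (M * α * (2 * κ * ‖r₀‖) * (κ * ‖r₀‖)) := by gcongr
    have h4 := (abs_le.mp (abs_real_inner_le_norm r₁ ((T - S) p₀))).1
    linarith
  have e1 := mul_le_mul_of_nonneg_left hpos hα.le
  have e2 := mul_le_mul_of_nonneg_left hTp (sq_nonneg α)
  have e3 : β * (α * l * ‖r₀‖ ^ 2 - α ^ 2 * (L ^ 2 * (κ ^ 2 * ‖r₀‖ ^ 2))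
      - 2 * α * (2 * M * α * κ ^ 2 * R * ‖r₀‖ ^ 2))
      ≤ β * (2 * α * ⟪r₁, S p₀⟫ + 2 * α * ⟪r₁, (T - S) p₀⟫) := by
    refine mul_le_mul_of_nonneg_left ?_ hβ0
    have f1 := mul_le_mul_of_nonneg_left hSp (sq_nonneg α)
    have f2 := mul_le_mul_of_nonneg_left hdrift (by positivity : 0 ≤ 2 * α)
    linarith
  have e4 : β * (α * l * ‖r₀‖ ^ 2 - α ^ 2 * (L ^ 2 * (κ ^ 2 * ‖r₀‖ ^ 2))
      - 2 * α * (2 * M * α * κ ^ 2 * R * ‖r₀‖ ^ 2))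
      = (α * l - α ^ 2 * L ^ 2 * κ ^ 2 - 4 * M * α ^ 2 * κ ^ 2 * R) * ‖r₁‖ ^ 2 := by
    rw [← hβr]; ring
  have e5 := mul_le_mul_of_nonneg_right hαL (mul_nonneg hα.le (sq_nonneg ‖r₁‖))
  rw [hexp, hinner]
  linarith

/-- FRGD with step size `α ≤ λmin / ((λmax² + 2·C·d·‖r_0‖)·K²)` under the
approximate-Hessian hypotheses satisfies `‖r_n‖ ≤ (1 − α·λmin)^(n/2)·‖r_0‖` for all
`0 ≤ n ≤ K`; in particular `(‖r_n‖)_{n ≤ K}` is nonincreasing. -/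
theorem frgd_geometric_decay {d : ℕ} (α C lmin lmax : ℝ) (K : ℕ)
    (w r p : ℕ → EuclideanSpace ℝ (Fin d)) (H : ℕ → Matrix (Fin d) (Fin d) ℝ)
    (hα : 0 < α) (hC : 0 < C) (hlmin : 0 < lmin) (hlm : lmin ≤ lmax) (hK : 1 ≤ K)
    (hp0 : p 0 = r 0)
    (hp : ∀ n, 1 ≤ n → p n = r n + (‖r n‖ ^ 2 / ‖r (n - 1)‖ ^ 2) • p (n - 1))
    (hw : ∀ n, w (n + 1) = w n - α • p n)
    (hrne : ∀ n ≤ K, r n ≠ 0)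
    (hH : ∀ n < K, r (n + 1) - r n = -α • Matrix.toEuclideanLin (H n) (p n))
    (hHpos : ∀ n < K, ∀ x : EuclideanSpace ℝ (Fin d),
      lmin * ‖x‖ ^ 2 ≤ ⟪x, Matrix.toEuclideanLin (H n) x⟫)
    (hHnorm : ∀ n < K, specNorm (H n) ≤ lmax)
    (hHdiff : ∀ n, 1 ≤ n → n < K →
      specNorm (H n - H (n - 1)) ≤ C * d * α * (‖p n‖ + ‖p (n - 1)‖))
    (hstep : α ≤ lmin / ((lmax ^ 2 + 2 * C * d * ‖r 0‖) * K ^ 2)) :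
    (∀ n ≤ K, ‖r n‖ ≤ (1 - α * lmin) ^ ((n : ℝ) / 2) * ‖r 0‖) ∧
    (∀ n, 1 ≤ n → n ≤ K → ‖r n‖ ≤ ‖r (n - 1)‖) := by
  let T : ℕ → EuclideanSpace ℝ (Fin d) →L[ℝ] EuclideanSpace ℝ (Fin d) :=
    fun n => LinearMap.toContinuousLinearMap (Matrix.toEuclideanLin (H n))
  have hTsub : ∀ m n, ‖T m - T n‖ = specNorm (H m - H n) := fun m n => by
    simp [T, specNorm]
  have hTstep : ∀ n < K, r (n + 1) = r n - α • T n (p n) := fun n hn => by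
    rw [sub_eq_add_neg, ← neg_smul]
    exact (sub_eq_iff_eq_add'.mp (hH n hn))
  have hL : 0 < lmax := hlmin.trans_le hlm
  have hM : 0 ≤ C * d := by positivity
  have hr0 : 0 < ‖r 0‖ := norm_pos_iff.mpr (hrne 0 (Nat.zero_le _))
  have hK1 : (1 : ℝ) ≤ K := by exact_mod_cast hK
  have hαK : α * ((lmax ^ 2 + 2 * (C * d) * ‖r 0‖) * K ^ 2) ≤ lmin := by
    rw [← mul_assoc 2 C]
    exact (le_div_iff₀ (by positivity)).mp hstep
  have hcontr : 0 ≤ α * lmin := by positivity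
  have hmono_of_contr : ∀ n, ‖r (n + 1)‖ ^ 2 ≤ (1 - α * lmin) * ‖r n‖ ^ 2 →
      ‖r (n + 1)‖ ≤ ‖r n‖ := fun n h => by
    refine le_of_pow_le_pow_left₀ two_ne_zero (norm_nonneg _) ?_
    nlinarith [sq_nonneg ‖r n‖]
  have key : ∀ n < K, ‖r (n + 1)‖ ^ 2 ≤ (1 - α * lmin) * ‖r n‖ ^ 2 ∧
      ‖p n‖ ≤ (n + 1 : ℝ) * ‖r n‖ ∧ ‖r n‖ ≤ ‖r 0‖ := by
    intro n
    induction n with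
    | zero =>
      intro hn
      refine ⟨?_, by simp [hp0], le_rfl⟩
      refine norm_sq_residual_first_step (T 0) hα (hp0 ▸ hTstep 0 hn) (hHpos 0 hn _)
        (hHnorm 0 hn) (le_trans ?_ hαK)
      have h1 : lmax ^ 2 ≤ lmax ^ 2 + 2 * (C * d) * ‖r 0‖ := by
        have : 0 ≤ 2 * (C * d) * ‖r 0‖ := by positivity
        linarith
      refine mul_le_mul_of_nonneg_left (h1.trans ?_) hα.le
      exact le_mul_of_one_le_right (by positivity) (one_le_pow₀ hK1)
    | succ n ih =>
      intro hn
      have hn' : n < K := by omega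
      obtain ⟨hdec, hpn, hrn⟩ := ih hn'
      have hmono := hmono_of_contr n hdec
      have hrn0 : 0 < ‖r n‖ := norm_pos_iff.mpr (hrne n hn'.le)
      have hnK : (n : ℝ) + 1 + 1 ≤ K := by exact_mod_cast hn
      have hpsucc := hp (n + 1) (by omega)
      rw [Nat.add_sub_cancel] at hpsucc
      have hpn' : ‖p (n + 1)‖ ≤ ((n + 1 : ℕ) + 1 : ℝ) * ‖r (n + 1)‖ := by
        have h1 : ‖(‖r (n + 1)‖ ^ 2 / ‖r n‖ ^ 2) • p n‖ ≤ (n + 1 : ℝ) * ‖r (n + 1)‖ := by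
          rw [norm_smul, Real.norm_of_nonneg (by positivity), div_mul_eq_mul_div,
            div_le_iff₀ (by positivity)]
          calc ‖r (n + 1)‖ ^ 2 * ‖p n‖
              ≤ (‖r (n + 1)‖ * ‖r n‖) * ((n + 1 : ℝ) * ‖r n‖) := by
                rw [sq]; gcongr
            _ = _ := by ring
        rw [hpsucc]
        refine (norm_add_le _ _).trans ?_
        push_cast
        linarith
      refine ⟨?_, hpn', hmono.trans hrn⟩
      refine norm_sq_residual_fletcherReeves_step (T n) (T (n + 1)) (κ := K) hα hM (by positivity)
        (hrne n hn'.le) hpsucc (hTstep n hn') (hTstep (n + 1) hn) (hHpos (n + 1) hn _)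
        (hHnorm n hn') (hHnorm (n + 1) hn) ?_ (hpn.trans ?_) (hpn'.trans ?_) hdec hmono
        (hmono.trans hrn) hαK
      · rw [hTsub]
        exact hHdiff (n + 1) (by omega) hn
      · gcongr
        linarith
      · push_cast
        gcongr
  have hbase : 0 ≤ 1 - α * lmin := by
    have h := (sq_nonneg _).trans (key 0 hK).1
    exact nonneg_of_mul_nonneg_left h (by positivity)
  refine ⟨fun n => ?_, fun n hn1 hnK => ?_⟩
  · intro hn
    have hsq : ‖r n‖ ^ 2 ≤ (1 - α * lmin) ^ n * ‖r 0‖ ^ 2 := by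
      induction n with
      | zero => simp
      | succ n ih =>
        refine (key n hn).1.trans ?_
        rw [pow_succ' (1 - α * lmin), mul_assoc]
        exact mul_le_mul_of_nonneg_left (ih (by omega)) hbase
    refine le_of_pow_le_pow_left₀ two_ne_zero (by positivity) ?_
    rw [mul_pow, ← Real.rpow_mul_natCast hbase, Nat.cast_ofNat, div_mul_cancel₀ _ two_ne_zero,
      Real.rpow_natCast]
    exact hsq
  · obtain ⟨m, rfl⟩ : ∃ m, n = m + 1 := ⟨n - 1, by omega⟩
    exact hmono_of_contr m (key m hnK).1
end

section
/- In the quadratic FRGD setting with a real d×d matrix A, for every n ≥ 1 (with r_k ≠ 0 for 0 ≤ k ≤ n−1) one has the Arnoldi-type relation A·Z_n = Z_n·T_n − (1/(α·‖r_{n−1}‖))·r_n·e_nᵀ, where r_n·e_nᵀ is the d×n rank-one matrix whose n-th column is r_n and whose other columns are zero. -/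
open scoped RealInnerProductSpace

/-- `d × n` matrix whose `k`-th column is the vector `v k`. -/
noncomputable def colMat {d : ℕ} (n : ℕ) (v : ℕ → EuclideanSpace ℝ (Fin d)) :
    Matrix (Fin d) (Fin n) ℝ :=
  Matrix.of fun i k => v (k : ℕ) i

/-- The `n × n` lower bidiagonal matrix with `1` on the diagonal and `−1` on the
subdiagonal. -/
noncomputable def Lmat (n : ℕ) : Matrix (Fin n) (Fin n) ℝ :=
  Matrix.of fun i j => if (i : ℕ) = (j : ℕ) then 1
    else if (i : ℕ) = (j : ℕ) + 1 then -1 else 0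

/-- The `n × n` upper bidiagonal matrix with `1` on the diagonal and superdiagonal entries
`−β 1, …, −β (n−1)`. -/
noncomputable def Umat (n : ℕ) (β : ℕ → ℝ) : Matrix (Fin n) (Fin n) ℝ :=
  Matrix.of fun i j => if (i : ℕ) = (j : ℕ) then 1
    else if (j : ℕ) = (i : ℕ) + 1 then -β (j : ℕ) else 0

/-- The diagonal matrix `diag (‖r 0‖, …, ‖r (n−1)‖)`. -/
noncomputable def Dmat {d : ℕ} (n : ℕ) (r : ℕ → EuclideanSpace ℝ (Fin d)) :
    Matrix (Fin n) (Fin n) ℝ :=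
  Matrix.diagonal fun k => ‖r (k : ℕ)‖

/-- The Fletcher–Reeves momentum coefficient `β k = ‖r k‖² / ‖r (k−1)‖²`. -/
noncomputable def frBeta {d : ℕ} (r : ℕ → EuclideanSpace ℝ (Fin d)) (k : ℕ) : ℝ :=
  ‖r k‖ ^ 2 / ‖r (k - 1)‖ ^ 2

/-- The tridiagonal matrix `T_n = (1/α)·D_n·L_n·U_n·D_n⁻¹`. -/
noncomputable def Tmat {d : ℕ} (α : ℝ) (n : ℕ) (r : ℕ → EuclideanSpace ℝ (Fin d)) :
    Matrix (Fin n) (Fin n) ℝ :=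
  (1 / α) • (Dmat n r * Lmat n * Umat n (frBeta r) * (Dmat n r)⁻¹)

/-- Right multiplication by `Lmat n` takes differences of consecutive columns. -/
theorem colMat_mul_Lmat_apply {d n : ℕ} (v : ℕ → EuclideanSpace ℝ (Fin d)) (i : Fin d)
    (k : Fin n) :
    (colMat n v * Lmat n) i k = v k i - if (k : ℕ) + 1 < n then v (k + 1) i else 0 := by
  have hsum : (colMat n v * Lmat n) i k = ∑ j ∈ Finset.range n,
      ((if j = (k : ℕ) then v k i else 0) - if j = (k : ℕ) + 1 then v (k + 1) i else 0) := by
    rw [Matrix.mul_apply, ← Fin.sum_univ_eq_sum_range (fun j =>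
      (if j = (k : ℕ) then v k i else 0) - if j = (k : ℕ) + 1 then v (k + 1) i else 0)]
    refine Finset.sum_congr rfl fun j _ => ?_
    simp only [colMat, Lmat, Matrix.of_apply]
    split_ifs <;> first | omega | simp_all
  rw [hsum, Finset.sum_sub_distrib, Finset.sum_ite_eq', Finset.sum_ite_eq']
  simp

theorem colMat_mul_Umat_apply {d n : ℕ} (v : ℕ → EuclideanSpace ℝ (Fin d)) (β : ℕ → ℝ)
    (i : Fin d) (k : Fin n) :
    (colMat n v * Umat n β) i k =
      v k i - if (k : ℕ) = 0 then 0 else β k * v (k - 1) i := by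
  have hsum : (colMat n v * Umat n β) i k = ∑ j ∈ Finset.range n,
      ((if j = (k : ℕ) then v k i else 0) -
        if j = (k : ℕ) - 1 then (if (k : ℕ) = 0 then 0 else β k * v (k - 1) i) else 0) := by
    rw [Matrix.mul_apply, ← Fin.sum_univ_eq_sum_range (fun j =>
      (if j = (k : ℕ) then v k i else 0) -
        if j = (k : ℕ) - 1 then (if (k : ℕ) = 0 then 0 else β k * v (k - 1) i) else 0)]
    refine Finset.sum_congr rfl fun j _ => ?_
    simp only [colMat, Umat, Matrix.of_apply]
    by_cases hjk : (j : ℕ) = k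
    · rw [if_pos hjk, if_pos hjk, hjk]
      by_cases hk : (k : ℕ) = 0
      · simp [hk]
      · rw [if_neg (by omega : ¬(k : ℕ) = k - 1)]
        ring
    · rw [if_neg hjk, if_neg hjk]
      by_cases hj : (k : ℕ) = j + 1
      · rw [if_pos hj, if_pos (by omega), if_neg (by omega), show (k : ℕ) - 1 = j by omega]
        ring
      · rw [if_neg hj, if_neg (by omega)]
        ring
  rw [hsum, Finset.sum_sub_distrib, Finset.sum_ite_eq', Finset.sum_ite_eq']
  have hk : (k : ℕ) - 1 < n := by omega
  simp [hk]

theorem mul_colMat_apply {d n : ℕ} (A : Matrix (Fin d) (Fin d) ℝ)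
    (v : ℕ → EuclideanSpace ℝ (Fin d)) (i : Fin d) (k : Fin n) :
    (A * colMat n v) i k = Matrix.toEuclideanLin A (v k) i := by
  simp [Matrix.mul_apply, colMat, Matrix.toLpLin_apply, Matrix.mulVec, dotProduct]

/-- in the quadratic FRGD setting the Arnoldi-type relation
`A·Z_n = Z_n·T_n − (1/(α·‖r_{n−1}‖))·r_n·e_nᵀ` holds, where `Z_n = R_n·D_n⁻¹`. -/
theorem quad_frgd_arnoldi {d : ℕ} (A : Matrix (Fin d) (Fin d) ℝ)
    (b : EuclideanSpace ℝ (Fin d)) (α : ℝ) (hα : 0 < α)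
    (w r p : ℕ → EuclideanSpace ℝ (Fin d))
    (hr : ∀ k, r k = Matrix.toEuclideanLin A (w k) - b)
    (hp0 : p 0 = r 0)
    (hp : ∀ k, 1 ≤ k → p k = r k + frBeta r k • p (k - 1))
    (hw : ∀ k, w (k + 1) = w k - α • p k)
    (n : ℕ) (hn : 1 ≤ n) (hrnz : ∀ k < n, r k ≠ 0) :
    A * (colMat n r * (Dmat n r)⁻¹) =
      (colMat n r * (Dmat n r)⁻¹) * Tmat α n r -
        (1 / (α * ‖r (n - 1)‖)) •
          Matrix.of (fun i (k : Fin n) => if (k : ℕ) = n - 1 then r n i else 0) := by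
  set E : Matrix (Fin d) (Fin n) ℝ :=
    Matrix.of (fun i (k : Fin n) => if (k : ℕ) = n - 1 then r n i else 0) with hE
  have hα' : α ≠ 0 := hα.ne'
  have hres : ∀ k, r (k + 1) = r k - α • Matrix.toEuclideanLin A (p k) := fun k => by
    rw [hr (k + 1), hr k, hw k, map_sub, map_smul]
    abel
  have hRU : colMat n r = colMat n p * Umat n (frBeta r) := by
    ext i k
    rw [colMat_mul_Umat_apply]
    split_ifs with hk
    · simp [colMat, hk, hp0]
    · simp [colMat, hp k (Nat.one_le_iff_ne_zero.mpr hk)]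
  have hAP : A * colMat n p = (1 / α) • (colMat n r * Lmat n - E) := by
    ext i k
    rw [mul_colMat_apply, Matrix.smul_apply, Matrix.sub_apply, colMat_mul_Lmat_apply]
    have hk := congrArg (fun x : EuclideanSpace ℝ (Fin d) => x i) (hres k)
    simp only [PiLp.sub_apply, PiLp.smul_apply, smul_eq_mul] at hk
    have hlast : (if (k : ℕ) + 1 < n then r (k + 1) i else 0) + E i k = r (k + 1) i := by
      rw [hE, Matrix.of_apply]
      by_cases h : (k : ℕ) + 1 < n
      · rw [if_pos h, if_neg (by omega), add_zero]
      · rw [if_neg h, if_pos (by omega), zero_add, show (k : ℕ) + 1 = n by omega]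
    rw [smul_eq_mul, sub_sub, hlast, hk]
    field_simp
    ring
  have hEU : E * Umat n (frBeta r) = E := by
    have hcol : E = colMat n fun j => if j = n - 1 then r n else 0 := by
      ext i k
      simp only [hE, colMat, Matrix.of_apply]
      split_ifs <;> rfl
    rw [hcol]
    ext i k
    rw [colMat_mul_Umat_apply]
    by_cases hk : (k : ℕ) = 0
    · simp [colMat, hk]
    · have hk' : (k : ℕ) - 1 ≠ n - 1 := by omega
      simp [colMat, hk, hk']
  have hD : IsUnit (Dmat n r).det := by
    rw [Dmat, Matrix.det_diagonal, isUnit_iff_ne_zero]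
    exact Finset.prod_ne_zero_iff.mpr fun k _ => norm_ne_zero_iff.mpr (hrnz k k.isLt)
  have hED : E * (Dmat n r)⁻¹ = (1 / ‖r (n - 1)‖) • E := by
    have hmul : E * Dmat n r = ‖r (n - 1)‖ • E := by
      ext i k
      simp only [Dmat, Matrix.mul_diagonal, Matrix.smul_apply, hE, Matrix.of_apply, smul_eq_mul]
      split_ifs with hk
      · rw [hk, mul_comm]
      · simp
    have hnorm : ‖r (n - 1)‖ ≠ 0 := norm_ne_zero_iff.mpr (hrnz _ (by omega))
    calc E * (Dmat n r)⁻¹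
        = (1 / ‖r (n - 1)‖) • (‖r (n - 1)‖ • E) * (Dmat n r)⁻¹ := by
          rw [smul_smul, one_div_mul_cancel hnorm, one_smul]
      _ = (1 / ‖r (n - 1)‖) • E := by
          rw [← hmul, Matrix.smul_mul, Matrix.mul_nonsing_inv_cancel_right _ _ hD]
  calc A * (colMat n r * (Dmat n r)⁻¹)
      = A * colMat n p * Umat n (frBeta r) * (Dmat n r)⁻¹ := by
        rw [Matrix.mul_assoc A, ← hRU, Matrix.mul_assoc]
    _ = (1 / α) • (colMat n r * Lmat n * Umat n (frBeta r) * (Dmat n r)⁻¹) -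
          (1 / (α * ‖r (n - 1)‖)) • E := by
        rw [hAP, Matrix.smul_mul, Matrix.smul_mul, Matrix.sub_mul, Matrix.sub_mul, hEU, hED,
          smul_sub, smul_smul, one_div_mul_one_div]
    _ = _ := by
        rw [Tmat, Matrix.mul_smul]
        simp only [← Matrix.mul_assoc]
        rw [Matrix.nonsing_inv_mul_cancel_right _ _ hD]
end

section
/- In the quadratic FRGD setting with a real d×d matrix A and r_k ≠ 0 for 0 ≤ k ≤ n−1, one has D_n·L_n·D_n^{−1} = L̂_n and D_n·U_n·D_n^{−1} = L̂_nᵀ, where L̂_n is the n×n lower bidiagonal matrix with 1 on the diagonal and subdiagonal entries −‖r_1‖/‖r_0‖, …, −‖r_{n−1}‖/‖r_{n−2}‖ (equivalently −√β_1, …, −√β_{n−1}). Consequently T_n = (1/α)·L̂_n·L̂_nᵀ, and in particular T_n is symmetric positive definite. -/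
open scoped RealInnerProductSpace

/-- The `n × n` lower bidiagonal matrix `L̂_n` with `1` on the diagonal and subdiagonal
entries `−‖r 1‖/‖r 0‖, …, −‖r (n−1)‖/‖r (n−2)‖`. -/
noncomputable def Lhat {d : ℕ} (n : ℕ) (r : ℕ → EuclideanSpace ℝ (Fin d)) :
    Matrix (Fin n) (Fin n) ℝ :=
  Matrix.of fun i j => if (i : ℕ) = (j : ℕ) then 1
    else if (i : ℕ) = (j : ℕ) + 1 then -(‖r (i : ℕ)‖ / ‖r (j : ℕ)‖) else 0

theorem inv_Dmat {d n : ℕ} {r : ℕ → EuclideanSpace ℝ (Fin d)} (hr : ∀ k < n, r k ≠ 0) :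
    (Dmat n r)⁻¹ = Matrix.diagonal fun k : Fin n => ‖r (k : ℕ)‖⁻¹ := by
  refine Matrix.inv_eq_left_inv ?_
  rw [Dmat, Matrix.diagonal_mul_diagonal, ← Matrix.diagonal_one]
  congr 1
  funext k
  exact inv_mul_cancel₀ (norm_ne_zero_iff.mpr (hr k k.isLt))

theorem inv_Dmat_mul_Dmat {d n : ℕ} {r : ℕ → EuclideanSpace ℝ (Fin d)}
    (hr : ∀ k < n, r k ≠ 0) : (Dmat n r)⁻¹ * Dmat n r = 1 := by
  refine Matrix.nonsing_inv_mul _ ?_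
  rw [Dmat, Matrix.det_diagonal, isUnit_iff_ne_zero]
  exact Finset.prod_ne_zero_iff.mpr fun k _ => norm_ne_zero_iff.mpr (hr k k.isLt)

theorem Dmat_mul_Lmat_mul_inv {d n : ℕ} {r : ℕ → EuclideanSpace ℝ (Fin d)}
    (hr : ∀ k < n, r k ≠ 0) : Dmat n r * Lmat n * (Dmat n r)⁻¹ = Lhat n r := by
  rw [inv_Dmat hr]
  ext i j
  have hj : ‖r (j : ℕ)‖ ≠ 0 := norm_ne_zero_iff.mpr (hr j j.isLt)
  rw [Matrix.mul_diagonal, Dmat, Matrix.diagonal_mul]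
  simp only [Lmat, Lhat, Matrix.of_apply]
  split_ifs with h₁ h₂
  · rw [h₁, mul_one, mul_inv_cancel₀ hj]
  · rw [div_eq_mul_inv]
    ring
  · simp

theorem Dmat_mul_Umat_frBeta_mul_inv {d n : ℕ} {r : ℕ → EuclideanSpace ℝ (Fin d)}
    (hr : ∀ k < n, r k ≠ 0) :
    Dmat n r * Umat n (frBeta r) * (Dmat n r)⁻¹ = (Lhat n r).transpose := by
  rw [inv_Dmat hr]
  ext i j
  have hi : ‖r (i : ℕ)‖ ≠ 0 := norm_ne_zero_iff.mpr (hr i i.isLt)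
  have hj : ‖r (j : ℕ)‖ ≠ 0 := norm_ne_zero_iff.mpr (hr j j.isLt)
  rw [Matrix.mul_diagonal, Dmat, Matrix.diagonal_mul, Matrix.transpose_apply]
  simp only [Umat, Lhat, Matrix.of_apply, eq_comm (a := (j : ℕ)) (b := (i : ℕ))]
  split_ifs with h₁ h₂
  · rw [h₁, mul_one, mul_inv_cancel₀ hj]
  · have hpred : (j : ℕ) - 1 = i := by omega
    rw [frBeta, hpred]
    field_simp
  · simp

theorem det_Lhat {d : ℕ} (n : ℕ) (r : ℕ → EuclideanSpace ℝ (Fin d)) : (Lhat n r).det = 1 := by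
  rw [Matrix.det_of_isLowerTriangular]
  · simp [Lhat]
  · intro i j hij
    have hlt : (i : ℕ) < j := hij
    simp only [Lhat, Matrix.of_apply]
    rw [if_neg (by omega), if_neg (by omega)]

theorem posDef_Lhat_mul_transpose {d : ℕ} (n : ℕ) (r : ℕ → EuclideanSpace ℝ (Fin d)) :
    (Lhat n r * (Lhat n r).transpose).PosDef := by
  rw [← Matrix.conjTranspose_eq_transpose_of_trivial]
  refine Matrix.PosDef.mul_conjTranspose_self _ (Matrix.vecMul_injective_of_isUnit ?_)
  rw [Matrix.isUnit_iff_isUnit_det, det_Lhat]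
  exact isUnit_one

theorem Tmat_eq_smul_Lhat_mul_transpose {d n : ℕ} (α : ℝ) {r : ℕ → EuclideanSpace ℝ (Fin d)}
    (hr : ∀ k < n, r k ≠ 0) : Tmat α n r = (1 / α) • (Lhat n r * (Lhat n r).transpose) := by
  rw [Tmat, ← Dmat_mul_Umat_frBeta_mul_inv hr, ← Dmat_mul_Lmat_mul_inv hr]
  congr 1
  simp only [Matrix.mul_assoc]
  rw [← Matrix.mul_assoc (Dmat n r)⁻¹ (Dmat n r), inv_Dmat_mul_Dmat hr, Matrix.one_mul]


/-- in the quadratic FRGD setting, `D_n·L_n·D_n⁻¹ = L̂_n`,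
`D_n·U_n·D_n⁻¹ = L̂_nᵀ`, consequently `T_n = (1/α)·L̂_n·L̂_nᵀ` and `T_n` is symmetric
positive definite. -/
theorem quad_frgd_T_cholesky {d : ℕ} (A : Matrix (Fin d) (Fin d) ℝ)
    (b : EuclideanSpace ℝ (Fin d)) (α : ℝ) (hα : 0 < α)
    (w r p : ℕ → EuclideanSpace ℝ (Fin d))
    (hr : ∀ k, r k = Matrix.toEuclideanLin A (w k) - b)
    (hp0 : p 0 = r 0)
    (hp : ∀ k, 1 ≤ k → p k = r k + frBeta r k • p (k - 1))
    (hw : ∀ k, w (k + 1) = w k - α • p k)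
    (n : ℕ) (hrnz : ∀ k < n, r k ≠ 0) :
    Dmat n r * Lmat n * (Dmat n r)⁻¹ = Lhat n r ∧
    Dmat n r * Umat n (frBeta r) * (Dmat n r)⁻¹ = (Lhat n r).transpose ∧
    Tmat α n r = (1 / α) • (Lhat n r * (Lhat n r).transpose) ∧
    (Tmat α n r).PosDef := by
  refine ⟨Dmat_mul_Lmat_mul_inv hrnz, Dmat_mul_Umat_frBeta_mul_inv hrnz,
    Tmat_eq_smul_Lhat_mul_transpose α hrnz, ?_⟩
  rw [Tmat_eq_smul_Lhat_mul_transpose α hrnz]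
  exact (posDef_Lhat_mul_transpose n r).smul (one_div_pos.mpr hα)
end

section
/- In the quadratic FRGD setting with r_k ≠ 0 for 0 ≤ k ≤ n−1, the matrix T_n = (1/α)·D_n·L_n·U_n·D_n^{−1} is invertible and satisfies e_nᵀ·T_n^{−1}·e_1 = α·‖r_{n−1}‖/‖r_0‖, where e_1 and e_n are the first and last standard basis vectors of ℝ^n. -/
open scoped RealInnerProductSpace

theorem det_Lmat (n : ℕ) : (Lmat n).det = 1 := by
  rw [Matrix.det_of_isLowerTriangular]
  · simp [Lmat]
  · intro i j hij
    have h : (i : ℕ) < j := hij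
    simp only [Lmat, Matrix.of_apply]
    rw [if_neg (by omega), if_neg (by omega)]

theorem det_Umat (n : ℕ) (β : ℕ → ℝ) : (Umat n β).det = 1 := by
  rw [Matrix.det_of_isUpperTriangular]
  · simp [Umat]
  · intro i j hij
    have h : (j : ℕ) < i := hij
    simp only [Umat, Matrix.of_apply]
    rw [if_neg (by omega), if_neg (by omega)]

theorem Lmat_mulVec_one (m : ℕ) :
    (Lmat (m + 1)).mulVec (fun _ => 1) = Pi.single 0 1 := by
  funext i
  have hsplit : ∀ j : Fin (m + 1), Lmat (m + 1) i j =
      (if i = j then 1 else 0) + (if (i : ℕ) = (j : ℕ) + 1 then -1 else 0) := by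
    intro j
    simp only [Lmat, Matrix.of_apply, Fin.ext_iff]
    split_ifs <;> first | omega | norm_num
  simp only [Matrix.mulVec, dotProduct, hsplit, mul_one, Finset.sum_add_distrib,
    Finset.sum_ite_eq, Finset.mem_univ, if_true]
  induction i using Fin.cases with
  | zero => simp
  | succ k =>
    have hk : ∀ j : Fin (m + 1), ((k.succ : Fin (m + 1)) : ℕ) = (j : ℕ) + 1 ↔ k.castSucc = j := by
      intro j
      simp [Fin.ext_iff]
    simp [hk, -Fin.val_succ]

theorem single_last_vecMul_Umat (m : ℕ) (β : ℕ → ℝ) :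
    Matrix.vecMul (Pi.single (Fin.last m) 1) (Umat (m + 1) β) = Pi.single (Fin.last m) 1 := by
  funext j
  have hj := j.isLt
  simp only [Matrix.single_one_vecMul, Matrix.row_apply, Umat, Matrix.of_apply, Pi.single_apply,
    Fin.ext_iff, Fin.val_last]
  split_ifs <;> first | omega | rfl

/-- The bottom-left entry of `U⁻¹ L⁻¹` is `1`. -/
theorem Umat_inv_mul_Lmat_inv_corner (m : ℕ) (β : ℕ → ℝ) :
    ((Umat (m + 1) β)⁻¹ * (Lmat (m + 1))⁻¹) (Fin.last m) 0 = 1 := by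
  have hU : IsUnit (Umat (m + 1) β).det := by simp [det_Umat]
  have hL : IsUnit (Lmat (m + 1)).det := by simp [det_Lmat]
  have h1 : Matrix.vecMul (Pi.single (Fin.last m) 1) (Umat (m + 1) β)⁻¹ =
      Pi.single (Fin.last m) 1 := by
    conv_lhs => rw [← single_last_vecMul_Umat m β]
    rw [Matrix.vecMul_vecMul, Matrix.mul_nonsing_inv _ hU, Matrix.vecMul_one]
  have h2 : (Lmat (m + 1))⁻¹.mulVec (Pi.single 0 1) = fun _ => 1 := by
    rw [← Lmat_mulVec_one, Matrix.mulVec_mulVec, Matrix.nonsing_inv_mul _ hL, Matrix.one_mulVec]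
  have hrow : ∀ j, (Umat (m + 1) β)⁻¹ (Fin.last m) j =
      (Pi.single (Fin.last m) 1 : Fin (m + 1) → ℝ) j := fun j => by
    simpa using congrFun h1 j
  have hcol : ∀ j, (Lmat (m + 1))⁻¹ j 0 = 1 := fun j => by
    simpa using congrFun h2 j
  simp [Matrix.mul_apply, hrow, hcol]

/-- in the quadratic FRGD setting, `T_n` is invertible and
`e_nᵀ·T_n⁻¹·e_1 = α·‖r (n−1)‖/‖r 0‖`, i.e. the bottom-left entry of `T_n⁻¹` equals
`α·‖r (n−1)‖/‖r 0‖`. -/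
theorem quad_frgd_Tinv_corner {d : ℕ} (A : Matrix (Fin d) (Fin d) ℝ)
    (b : EuclideanSpace ℝ (Fin d)) (α : ℝ) (hα : 0 < α)
    (w r p : ℕ → EuclideanSpace ℝ (Fin d))
    (hr : ∀ k, r k = Matrix.toEuclideanLin A (w k) - b)
    (hp0 : p 0 = r 0)
    (hp : ∀ k, 1 ≤ k → p k = r k + frBeta r k • p (k - 1))
    (hw : ∀ k, w (k + 1) = w k - α • p k)
    (n : ℕ) (hn : 1 ≤ n) (hrnz : ∀ k < n, r k ≠ 0) :
    IsUnit (Tmat α n r).det ∧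
    (Tmat α n r)⁻¹ ⟨n - 1, by omega⟩ ⟨0, by omega⟩ = α * ‖r (n - 1)‖ / ‖r 0‖ := by
  obtain ⟨m, rfl⟩ : ∃ m, n = m + 1 := ⟨n - 1, by omega⟩
  have hnorm : ∀ k : Fin (m + 1), ‖r k‖ ≠ 0 := fun k => norm_ne_zero_iff.2 (hrnz k k.isLt)
  have hDdet : IsUnit (Dmat (m + 1) r).det := by
    rw [Dmat, Matrix.det_diagonal]
    exact (Finset.prod_ne_zero_iff.2 fun k _ => hnorm k).isUnit
  have hDinv : (Dmat (m + 1) r)⁻¹ = Matrix.diagonal fun k : Fin (m + 1) => ‖r k‖⁻¹ := by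
    apply Matrix.inv_eq_right_inv
    simp [Dmat, Matrix.diagonal_mul_diagonal, hnorm]
  have hBdet : IsUnit (Dmat (m + 1) r * Lmat (m + 1) * Umat (m + 1) (frBeta r) *
      (Dmat (m + 1) r)⁻¹).det := by
    rw [Matrix.det_mul, Matrix.det_mul, Matrix.det_mul, det_Lmat, det_Umat, mul_one, mul_one]
    exact hDdet.mul (Matrix.isUnit_nonsing_inv_det _ hDdet)
  have hα' : (1 / α) ≠ 0 := one_div_ne_zero hα.ne'
  refine ⟨?_, ?_⟩
  · rw [Tmat, Matrix.det_smul]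
    exact (pow_ne_zero _ hα').isUnit.mul hBdet
  · have hinv : (Tmat α (m + 1) r)⁻¹ = α • (Dmat (m + 1) r *
        ((Umat (m + 1) (frBeta r))⁻¹ * (Lmat (m + 1))⁻¹) * (Dmat (m + 1) r)⁻¹) := by
      have h := Matrix.inv_smul' _ (Units.mk0 _ hα') hBdet
      simp only [Units.smul_def, Units.val_mk0, Units.val_inv_eq_inv_val, one_div, inv_inv] at h
      rw [Tmat, one_div, h]
      simp only [Matrix.mul_inv_rev, Matrix.nonsing_inv_nonsing_inv _ hDdet, mul_assoc]
    have hcorner := Umat_inv_mul_Lmat_inv_corner m (frBeta r)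
    change (Tmat α (m + 1) r)⁻¹ (Fin.last m) 0 = _
    rw [hinv, hDinv, Matrix.smul_apply, Matrix.mul_diagonal, Dmat, Matrix.diagonal_mul, hcorner]
    simp [div_eq_mul_inv, mul_assoc]
end
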